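/- arXiv:2107.03750 — 5 statements merged into one kernel-verified Lean document; each statement's English description precedes it below -/
import Mathlib

section
/- Let k be a positive integer and let H be a finite simple graph such that every finite simple graph that is both H-free and triangle-free is k-colorable. Then every finite simple graph G that is H-free, bull-free and diamond-free satisfies χ(G) ≤ max{2k, ω(G)}. -/
open SimpleGraph

/-- `G` is `H`-free: no induced subgraph of `G` is isomorphic to `H`. -/
def IsIndFree {V W : Type*} (G : SimpleGraph V) (H : SimpleGraph W) : Prop :=
  ∀ s : Set V, ¬ Nonempty (H ≃g G.induce s)

/-- The bull: a triangle with two pendant edges at distinct vertices. -/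
def bull : SimpleGraph (Fin 5) :=
  SimpleGraph.fromEdgeSet {s(0,1), s(1,2), s(0,2), s(1,3), s(2,4)}

/-- The diamond: `K₄` minus an edge. -/
def diamond : SimpleGraph (Fin 4) :=
  SimpleGraph.fromEdgeSet {s(0,2), s(0,3), s(1,2), s(1,3), s(2,3)}

/-- An induced copy of `H` in `G` may be given as a graph embedding. -/
theorem isIndFree_iff_isEmpty_embedding {V W : Type*} {G : SimpleGraph V} {H : SimpleGraph W} :
    IsIndFree G H ↔ IsEmpty (H ↪g G) := by
  constructor
  · intro h
    refine ⟨fun f => h (Set.range f) ⟨⟨Equiv.ofInjective f f.injective, ?_⟩⟩⟩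
    intro a b
    simp
  · rintro h s ⟨e⟩
    exact h.false (e.toEmbedding.trans (SimpleGraph.Embedding.induce s))

theorem IsIndFree.induce {V W : Type*} {G : SimpleGraph V} {H : SimpleGraph W}
    (h : IsIndFree G H) (s : Set V) : IsIndFree (G.induce s) H := by
  rw [isIndFree_iff_isEmpty_embedding] at h ⊢
  exact ⟨fun f => h.false (f.trans (SimpleGraph.Embedding.induce s))⟩

/-- In a diamond-free graph, two vertices with two adjacent common neighbours are adjacent. -/
theorem IsIndFree.adj_of_diamond {V : Type*} {G : SimpleGraph V} (h : IsIndFree G diamond)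
    {a b c d : V} (hab : a ≠ b) (hac : G.Adj a c) (had : G.Adj a d) (hbc : G.Adj b c)
    (hbd : G.Adj b d) (hcd : G.Adj c d) : G.Adj a b := by
  by_contra hn
  rw [isIndFree_iff_isEmpty_embedding] at h
  have hn' : ¬ G.Adj b a := fun h => hn h.symm
  refine h.false ⟨⟨![a, b, c, d], ?_⟩, ?_⟩
  · intro i j hij
    fin_cases i <;> fin_cases j <;>
      simp_all [hab.symm, hac.ne, had.ne, hbc.ne, hbd.ne, hcd.ne,
        hac.ne', had.ne', hbc.ne', hbd.ne', hcd.ne']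
  · intro i j
    change G.Adj (![a, b, c, d] i) (![a, b, c, d] j) ↔ _
    fin_cases i <;> fin_cases j <;>
      simp [diamond, hn, hn', hac, had, hbc, hbd, hcd, hac.symm, had.symm, hbc.symm, hbd.symm,
        hcd.symm]

/-- In a bull-free graph, private neighbours of two vertices of a triangle are adjacent. -/
theorem IsIndFree.adj_of_bull {V : Type*} {G : SimpleGraph V} (h : IsIndFree G bull)
    {a b c x y : V} (hab : G.Adj a b) (hac : G.Adj a c) (hbc : G.Adj b c)
    (hax : G.Adj a x) (hby : G.Adj b y) (hbx : ¬ G.Adj b x) (hcx : ¬ G.Adj c x)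
    (hay : ¬ G.Adj a y) (hcy : ¬ G.Adj c y) : G.Adj x y := by
  by_contra hn
  rw [isIndFree_iff_isEmpty_embedding] at h
  have hxy : x ≠ y := by rintro rfl; exact hay hax
  have hxb : x ≠ b := by rintro rfl; exact hn hby
  have hxc : x ≠ c := by rintro rfl; exact hbx hbc
  have hya : y ≠ a := by rintro rfl; exact hn hax.symm
  have hyc : y ≠ c := by rintro rfl; exact hay hac
  refine h.false ⟨⟨![c, a, b, x, y], ?_⟩, ?_⟩
  · intro i j hij
    fin_cases i <;> fin_cases j <;>
      simp_all [hab.ne, hac.ne, hbc.ne, hax.ne, hby.ne, hab.ne', hac.ne', hbc.ne', hax.ne',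
        hby.ne', hxy.symm, hxb.symm, hxc.symm, hya.symm, hyc.symm]
  · intro i j
    change G.Adj (![c, a, b, x, y] i) (![c, a, b, x, y] j) ↔ _
    fin_cases i <;> fin_cases j <;>
      simp [bull, hab, hac, hbc, hax, hby, hbx, hcx, hay, hcy, hn, hab.symm, hac.symm, hbc.symm,
        hax.symm, hby.symm, G.adj_comm x, G.adj_comm y]

section MaximalClique

variable {V : Type*} {G : SimpleGraph V} {K s : Finset V}

/-- In a diamond-free graph, a vertex outside a maximal clique `K` of `s` has at most one
neighbour in `K`. -/
theorem IsIndFree.not_adj_of_maximal_clique (hd : IsIndFree G diamond)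
    (hK : G.IsClique (K : Set V))
    (hmax : ∀ x ∈ s, (∀ a ∈ K, G.Adj x a) → x ∈ K) {a b x : V} (ha : a ∈ K) (hb : b ∈ K)
    (hab : a ≠ b) (hx : x ∈ s) (hxK : x ∉ K) (hax : G.Adj a x) : ¬ G.Adj b x := by
  intro hbx
  refine hxK (hmax x hx fun c hc => ?_)
  by_cases hca : c = a
  · exact hca ▸ hax.symm
  by_cases hcb : c = b
  · exact hcb ▸ hbx.symm
  exact hd.adj_of_diamond (by rintro rfl; exact hxK hc) hax.symm hbx.symm
    (hK hc ha hca) (hK hc hb hcb) (hK ha hb hab)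

/-- In a (bull, diamond)-free graph, outside neighbours of distinct vertices of a maximal clique
with at least three vertices are adjacent. -/
theorem IsIndFree.adj_of_maximal_clique (hb : IsIndFree G bull) (hd : IsIndFree G diamond)
    (hK : G.IsClique (K : Set V))
    (hmax : ∀ x ∈ s, (∀ a ∈ K, G.Adj x a) → x ∈ K) (hcard : 3 ≤ K.card)
    {a b x y : V} (ha : a ∈ K) (hbK : b ∈ K) (hab : a ≠ b) (hx : x ∈ s) (hxK : x ∉ K)
    (hy : y ∈ s) (hyK : y ∉ K) (hax : G.Adj a x) (hby : G.Adj b y) : G.Adj x y := by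
  classical
  obtain ⟨c, hc, hcab⟩ : ∃ c ∈ K, c ∉ ({a, b} : Finset V) :=
    Finset.exists_mem_notMem_of_card_lt_card (Finset.card_le_two.trans_lt hcard)
  simp only [Finset.mem_insert, Finset.mem_singleton, not_or] at hcab
  have key {u v z : V} (hu : u ∈ K) (hv : v ∈ K) (huv : u ≠ v) (hz : z ∈ s) (hzK : z ∉ K) :=
    hd.not_adj_of_maximal_clique hK hmax hu hv huv hz hzK
  exact hb.adj_of_bull (hK ha hbK hab) (hK ha hc (Ne.symm hcab.1)) (hK hbK hc (Ne.symm hcab.2))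
    hax hby (key ha hbK hab hx hxK hax) (key ha hc (Ne.symm hcab.1) hx hxK hax)
    (key hbK ha hab.symm hy hyK hby) (key hbK hc (Ne.symm hcab.2) hy hyK hby)

/-- In a (bull, diamond)-free graph, if every vertex of a maximal clique with at least three
vertices has an outside neighbour, then these neighbours are unique. -/
theorem IsIndFree.eq_of_maximal_clique (hb : IsIndFree G bull) (hd : IsIndFree G diamond)
    (hK : G.IsClique (K : Set V))
    (hmax : ∀ x ∈ s, (∀ a ∈ K, G.Adj x a) → x ∈ K) (hcard : 3 ≤ K.card)
    (hout : ∀ a ∈ K, ∃ x ∈ s, x ∉ K ∧ G.Adj a x)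
    {a x y : V} (ha : a ∈ K) (hx : x ∈ s) (hxK : x ∉ K) (hax : G.Adj a x)
    (hy : y ∈ s) (hyK : y ∉ K) (hay : G.Adj a y) : x = y := by
  classical
  by_contra hxy
  obtain ⟨b, hbK, hba⟩ : ∃ b ∈ K, b ≠ a :=
    Finset.exists_mem_ne (by omega) a
  obtain ⟨c, hc, hcab⟩ : ∃ c ∈ K, c ∉ ({a, b} : Finset V) :=
    Finset.exists_mem_notMem_of_card_lt_card (Finset.card_le_two.trans_lt hcard)
  simp only [Finset.mem_insert, Finset.mem_singleton, not_or] at hcab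
  obtain ⟨u, hu, huK, hbu⟩ := hout b hbK
  obtain ⟨v, hv, hvK, hcv⟩ := hout c hc
  have key {p q z w : V} (hp : p ∈ K) (hq : q ∈ K) (hpq : p ≠ q) (hz : z ∈ s) (hzK : z ∉ K)
      (hw : w ∈ s) (hwK : w ∉ K) :=
    hb.adj_of_maximal_clique hd hK hmax hcard hp hq hpq hz hzK hw hwK
  have hxu := key ha hbK hba.symm hx hxK hu huK hax hbu
  have hyu := key ha hbK hba.symm hy hyK hu huK hay hbu
  have hxv := key ha hc (Ne.symm hcab.1) hx hxK hv hvK hax hcv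
  have hyv := key ha hc (Ne.symm hcab.1) hy hyK hv hvK hay hcv
  have huv := key hbK hc (Ne.symm hcab.2) hu huK hv hvK hbu hcv
  have hadj : G.Adj x y := hd.adj_of_diamond hxy hxu hxv hyu hyv huv
  exact hd.not_adj_of_maximal_clique hK hmax hbK ha hba hu huK hbu
    (hd.adj_of_diamond (by rintro rfl; exact huK ha) hax hay hxu.symm hyu.symm hadj)

end MaximalClique

/-- A (bull, diamond)-free graph without cliques on more than `m` vertices is `m`-colorable as soon
as its triangle-free induced subgraphs are. -/
theorem colorable_of_bull_diamond_free {V : Type*} [Fintype V] {G : SimpleGraph V} {m : ℕ}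
    (hm : 0 < m) (hb : IsIndFree G bull) (hd : IsIndFree G diamond)
    (hclique : ∀ K : Finset V, G.IsClique (K : Set V) → K.card ≤ m)
    (htri : ∀ s : Set V, (G.induce s).CliqueFree 3 → (G.induce s).Colorable m) :
    G.Colorable m := by
  classical
  suffices h : ∀ s : Finset V, ∃ c : V → Fin m, ∀ u ∈ s, ∀ v ∈ s, G.Adj u v → c u ≠ c v by
    obtain ⟨c, hc⟩ := h Finset.univ
    exact ⟨Coloring.mk c fun {u v} huv => hc u (Finset.mem_univ u) v (Finset.mem_univ v) huv⟩
  intro s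
  induction s using Finset.strongInduction with
  | H s ih =>
  by_cases hfree : (G.induce (s : Set V)).CliqueFree 3
  · obtain ⟨c⟩ := htri s hfree
    refine ⟨fun v => if hv : v ∈ (s : Set V) then c ⟨v, hv⟩ else ⟨0, hm⟩, fun u hu v hv huv => ?_⟩
    have hu' : u ∈ (s : Set V) := hu
    have hv' : v ∈ (s : Set V) := hv
    simp only [hu', hv', dif_pos]
    exact c.valid (by simpa using huv)
  obtain ⟨T, hTs, hT, hTcard⟩ : ∃ T ⊆ s, G.IsClique (T : Set V) ∧ T.card = 3 := by
    simp only [CliqueFree, not_forall, not_not] at hfree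
    obtain ⟨t, ht⟩ := hfree
    have h := ht.map (f := Function.Embedding.subtype (· ∈ (s : Set V)))
    refine ⟨t.map (Function.Embedding.subtype _), ?_, ?_, h.card_eq⟩
    · intro v hv
      obtain ⟨w, -, rfl⟩ := Finset.mem_map.1 hv
      exact w.2
    · exact h.isClique.mono (SimpleGraph.map_le_iff_le_comap _ _ _ |>.2 le_rfl)
  obtain ⟨K, hK, hKmax⟩ := Finset.exists_max_image
    (s.powerset.filter fun K : Finset V => G.IsClique (K : Set V)) Finset.card
    ⟨T, by simp [hTs, hT]⟩
  simp only [Finset.mem_filter, Finset.mem_powerset] at hK hKmax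
  obtain ⟨hKs, hK⟩ := hK
  have hcard : 3 ≤ K.card := hTcard ▸ hKmax T ⟨hTs, hT⟩
  have hmax : ∀ x ∈ s, (∀ a ∈ K, G.Adj x a) → x ∈ K := by
    intro x hx hadj
    by_contra hxK
    have h := hKmax (insert x K) ⟨Finset.insert_subset hx hKs, by
      rw [Finset.coe_insert]
      exact hK.insert fun a ha _ => hadj a ha⟩
    rw [Finset.card_insert_of_notMem hxK] at h
    omega
  by_cases hout : ∀ a ∈ K, ∃ x ∈ s, x ∉ K ∧ G.Adj a x
  · have hout' : ∀ a, ∃ x, a ∈ K → x ∈ s ∧ x ∉ K ∧ G.Adj a x := by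
      intro a
      by_cases ha : a ∈ K
      · obtain ⟨x, hx⟩ := hout a ha
        exact ⟨x, fun _ => hx⟩
      · exact ⟨a, fun h => absurd h ha⟩
    choose n hn using hout'
    have hKne : K.Nonempty := Finset.card_pos.1 (by omega)
    have hKnt : (K : Set V).Nontrivial := Finset.one_lt_card_iff_nontrivial.1 (by omega)
    obtain ⟨c, hc⟩ := ih (s \ K) (Finset.sdiff_ssubset hKs hKne)
    obtain ⟨σ, hσ, -⟩ := K.exists_cycleOn
    have hσK {a : V} (ha : a ∈ K) : σ a ∈ K := hσ.1.mapsTo ha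
    have hcn {a b : V} (ha : a ∈ K) (hbK : b ∈ K) (hab : a ≠ b) : c (n a) ≠ c (n b) := by
      obtain ⟨h1, h2, h3⟩ := hn a ha
      obtain ⟨h4, h5, h6⟩ := hn b hbK
      exact hc _ (Finset.mem_sdiff.2 ⟨h1, h2⟩) _ (Finset.mem_sdiff.2 ⟨h4, h5⟩)
        (hb.adj_of_maximal_clique hd hK hmax hcard ha hbK hab h1 h2 h4 h5 h3 h6)
    have hmixed {a v : V} (ha : a ∈ K) (hv : v ∈ s) (hvK : v ∉ K) (hav : G.Adj a v) :
        c (n (σ a)) ≠ c v := by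
      obtain ⟨h1, h2, h3⟩ := hn a ha
      rw [hb.eq_of_maximal_clique hd hK hmax hcard hout ha hv hvK hav h1 h2 h3]
      exact hcn (hσK ha) ha (hσ.apply_ne hKnt ha)
    refine ⟨fun v => if v ∈ K then c (n (σ v)) else c v, fun u hu v hv huv => ?_⟩
    by_cases huK : u ∈ K <;> by_cases hvK : v ∈ K <;> simp only [huK, hvK, if_true, if_false]
    · exact hcn (hσK huK) (hσK hvK) (σ.injective.ne huv.ne)
    · exact hmixed huK hv hvK huv
    · exact (hmixed hvK hu huK huv.symm).symm
    · exact hc u (Finset.mem_sdiff.2 ⟨hu, huK⟩) v (Finset.mem_sdiff.2 ⟨hv, hvK⟩) huv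
  · push Not at hout
    obtain ⟨a, ha, hna⟩ := hout
    obtain ⟨c, hc⟩ := ih (s.erase a) (Finset.erase_ssubset (hKs ha))
    obtain ⟨i, -, hi⟩ : ∃ i ∈ (Finset.univ : Finset (Fin m)), i ∉ (K.erase a).image c := by
      refine Finset.exists_mem_notMem_of_card_lt_card ?_
      have h1 := hclique K hK
      have h2 := Finset.card_image_le (s := K.erase a) (f := c)
      rw [Finset.card_erase_of_mem ha] at h2
      rw [Finset.card_univ, Fintype.card_fin]
      omega
    have hnew {v : V} (hv : v ∈ s) (hav : G.Adj a v) : i ≠ c v := by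
      rintro rfl
      refine hi (Finset.mem_image_of_mem c (Finset.mem_erase.2 ⟨hav.ne', ?_⟩))
      by_contra hvK
      exact hna v hv hvK hav
    refine ⟨Function.update c a i, fun u hu v hv huv => ?_⟩
    by_cases hua : u = a
    · subst hua
      rw [Function.update_self, Function.update_of_ne huv.ne']
      exact hnew hv huv
    by_cases hva : v = a
    · subst hva
      rw [Function.update_self, Function.update_of_ne hua]
      exact (hnew hu huv.symm).symm
    rw [Function.update_of_ne hua, Function.update_of_ne hva]
    exact hc u (Finset.mem_erase.2 ⟨hua, hu⟩) v (Finset.mem_erase.2 ⟨hva, hv⟩) huv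

theorem statement_0 {W : Type} [Fintype W] (H : SimpleGraph W) (k : ℕ) (hk : 0 < k)
    (hH : ∀ (U : Type) [Fintype U] (F : SimpleGraph U),
      IsIndFree F H → F.CliqueFree 3 → F.Colorable k)
    {V : Type} [Fintype V] (G : SimpleGraph V)
    (hGH : IsIndFree G H) (hGb : IsIndFree G bull) (hGd : IsIndFree G diamond) :
    G.chromaticNumber ≤ (max (2 * k) G.cliqueNum : ℕ∞) := by
  classical
  have h : G.Colorable (max (2 * k) G.cliqueNum) :=
    colorable_of_bull_diamond_free (lt_max_of_lt_left (by omega)) hGb hGd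
      (fun K hK => le_max_of_le_right hK.card_le_cliqueNum)
      (fun s hs => (hH s (G.induce s) (hGH.induce s) hs).mono (le_max_of_le_left (by omega)))
  exact_mod_cast h.chromaticNumber_le
end

section
/- Let G be a finite simple graph that is bull-free and diamond-free, and let k be a positive integer such that every triangle-free induced subgraph of G is k-colorable. Then χ(G) ≤ max{2k, ω(G)}. -/
open SimpleGraph

/-- An `H`-free graph admits no injection of `H` that preserves and reflects adjacency. -/
theorem IsIndFree.false_of_injective {V W : Type*} {G : SimpleGraph V} {H : SimpleGraph W}
    (h : IsIndFree G H) (f : W → V) (hf : Function.Injective f)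
    (hadj : ∀ a b, G.Adj (f a) (f b) ↔ H.Adj a b) : False :=
  h (Set.range f) ⟨⟨Equiv.ofInjective f hf, hadj _ _⟩⟩

/-- In a diamond-free graph, distinct common neighbours of an edge are adjacent. -/
theorem IsIndFree.adj_of_diamond_s1 {V : Type*} {G : SimpleGraph V} (h : IsIndFree G diamond)
    {x y p q : V} (hxy : x ≠ y) (hpq : G.Adj p q) (hxp : G.Adj x p) (hxq : G.Adj x q)
    (hyp : G.Adj y p) (hyq : G.Adj y q) : G.Adj x y := by
  by_contra hn
  have hn' : ¬ G.Adj y x := fun e => hn e.symm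
  refine h.false_of_injective ![x, y, p, q] ?_ ?_
  · intro a b hab
    fin_cases a <;> fin_cases b <;>
      simp_all [hxp.ne, hxq.ne, hyp.ne, hyq.ne, hpq.ne, hxp.ne', hxq.ne', hyp.ne', hyq.ne',
        hpq.ne', hxy.symm]
  · intro a b
    fin_cases a <;> fin_cases b <;>
      simp [diamond, hn, hn', hpq, hxp, hxq, hyp, hyq, hpq.symm, hxp.symm, hxq.symm, hyp.symm,
        hyq.symm]

/-- In a bull-free graph, private neighbours of two vertices of a triangle are adjacent. -/
theorem IsIndFree.adj_of_bull_s1 {V : Type*} {G : SimpleGraph V} (h : IsIndFree G bull)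
    {a b c u v : V} (hab : G.Adj a b) (hbc : G.Adj b c) (hac : G.Adj a c)
    (hau : G.Adj a u) (hbv : G.Adj b v) (hbu : ¬ G.Adj b u) (hcu : ¬ G.Adj c u)
    (hav : ¬ G.Adj a v) (hcv : ¬ G.Adj c v) : G.Adj u v := by
  by_contra hn
  have hne : u ≠ v := by rintro rfl; exact hbu hbv
  have hcu' : c ≠ u := by rintro rfl; exact hbu hbc
  have hcv' : c ≠ v := by rintro rfl; exact hav hac
  have hbu' : b ≠ u := by rintro rfl; exact hcu hbc.symm
  have hav' : a ≠ v := by rintro rfl; exact hcv hac.symm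
  refine h.false_of_injective ![c, a, b, u, v] ?_ ?_
  · intro x y hxy
    fin_cases x <;> fin_cases y <;>
      simp_all [hab.ne, hbc.ne, hac.ne, hau.ne, hbv.ne, hab.ne', hbc.ne', hac.ne', hau.ne',
        hbv.ne', hne.symm, hcu'.symm, hcv'.symm, hbu'.symm, hav'.symm]
  · intro x y
    fin_cases x <;> fin_cases y <;>
      simp [bull, hn, hab, hbc, hac, hau, hbv, hbu, hcu, hav, hcv, hab.symm, hbc.symm, hac.symm,
        hau.symm, hbv.symm, G.adj_comm u, G.adj_comm v]

/-- In a diamond-free graph, a vertex outside a maximal clique has at most one neighbour in it. -/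
theorem IsIndFree.eq_of_adj_maximal_clique {V : Type*} {G : SimpleGraph V}
    (h : IsIndFree G diamond) {K : Finset V} (hK : G.IsClique (K : Set V)) {v : V}
    (hv : v ∉ K) (hmax : ¬ ∀ c ∈ K, G.Adj v c) {a b : V} (ha : a ∈ K) (hb : b ∈ K)
    (hva : G.Adj v a) (hvb : G.Adj v b) : a = b := by
  by_contra hab
  refine hmax fun c hc => ?_
  by_cases hca : c = a
  · exact hca ▸ hva
  by_cases hcb : c = b
  · exact hcb ▸ hvb
  exact h.adj_of_diamond_s1 (by rintro rfl; exact hv hc) (hK ha hb hab) hva hvb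
    (hK hc ha hca) (hK hc hb hcb)

/-- If each vertex of a maximal clique of order at least three has a neighbour outside it, then
these neighbours are unique and pairwise adjacent. -/
theorem IsIndFree.outer_neighbors {V : Type*} {G : SimpleGraph V} (hGb : IsIndFree G bull)
    (hGd : IsIndFree G diamond) {s K : Finset V} (hK : G.IsClique (K : Set V))
    (hcard : 2 < K.card) (hmax : ∀ v ∈ s, v ∉ K → ¬ ∀ c ∈ K, G.Adj v c)
    (hout : ∀ v ∈ K, ∃ w ∈ s, w ∉ K ∧ G.Adj v w) :
    (∀ a ∈ K, ∀ b ∈ K, a ≠ b → ∀ u ∈ s, u ∉ K → G.Adj a u →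
      ∀ v ∈ s, v ∉ K → G.Adj b v → G.Adj u v) ∧
    (∀ a ∈ K, ∀ u ∈ s, u ∉ K → G.Adj a u → ∀ v ∈ s, v ∉ K → G.Adj a v → u = v) := by
  classical
  have third : ∀ a b : V, ∃ c ∈ K, c ≠ a ∧ c ≠ b := by
    intro a b
    obtain ⟨c, hc, hc'⟩ := Finset.exists_mem_notMem_of_card_lt_card
      (lt_of_le_of_lt (Finset.card_le_two (a := a) (b := b)) hcard)
    exact ⟨c, hc, by simpa using hc'⟩
  have uniq : ∀ u ∈ s, u ∉ K → ∀ a ∈ K, ∀ b ∈ K, G.Adj a u → G.Adj b u → a = b :=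
    fun u hu huK a ha b hb hau hbu =>
      hGd.eq_of_adj_maximal_clique hK huK (hmax u hu huK) ha hb hau.symm hbu.symm
  have key : ∀ a ∈ K, ∀ b ∈ K, a ≠ b → ∀ u ∈ s, u ∉ K → G.Adj a u →
      ∀ v ∈ s, v ∉ K → G.Adj b v → G.Adj u v := by
    intro a ha b hb hab u hu huK hau v hv hvK hbv
    obtain ⟨c, hc, hca, hcb⟩ := third a b
    exact hGb.adj_of_bull_s1 (hK ha hb hab) (hK hb hc hcb.symm) (hK ha hc hca.symm) hau hbv
      (fun e => hab (uniq u hu huK a ha b hb hau e))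
      (fun e => hca (uniq u hu huK c hc a ha e hau))
      (fun e => hab (uniq v hv hvK a ha b hb e hbv))
      (fun e => hcb (uniq v hv hvK c hc b hb e hbv))
  refine ⟨key, fun c hc w hw hwK hcw w' hw' hwK' hcw' => ?_⟩
  by_contra hne
  obtain ⟨a, ha, hac, -⟩ := third c c
  obtain ⟨b, hb, hbc, hba⟩ := third c a
  obtain ⟨u, hu, huK, hau⟩ := hout a ha
  obtain ⟨v, hv, hvK, hbv⟩ := hout b hb
  have huw := key a ha c hc hac u hu huK hau w hw hwK hcw
  have huw' := key a ha c hc hac u hu huK hau w' hw' hwK' hcw'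
  have hvw := key b hb c hc hbc v hv hvK hbv w hw hwK hcw
  have hvw' := key b hb c hc hbc v hv hvK hbv w' hw' hwK' hcw'
  have huv := key a ha b hb hba.symm u hu huK hau v hv hvK hbv
  have hww' : G.Adj w w' :=
    hGd.adj_of_diamond_s1 hne huv huw.symm hvw.symm huw'.symm hvw'.symm
  have hcu : G.Adj c u :=
    hGd.adj_of_diamond_s1 (by rintro rfl; exact huK hc) hww' hcw hcw' huw huw'
  exact hac (uniq u hu huK a ha c hc hau hcu)

/-- A bull-free and diamond-free graph whose triangle-free induced subgraphs are all
`n`-colorable is `n`-colorable as soon as its cliques have order at most `n`. -/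
theorem IsIndFree.exists_coloring {V : Type*} [Fintype V] {G : SimpleGraph V}
    (hGb : IsIndFree G bull) (hGd : IsIndFree G diamond) {n : ℕ} (hn : 0 < n)
    (hcol : ∀ s : Set V, (G.induce s).CliqueFree 3 → (G.induce s).Colorable n)
    (hclique : ∀ K : Finset V, G.IsClique (K : Set V) → K.card ≤ n) (s : Finset V) :
    ∃ c : V → Fin n, ∀ u ∈ s, ∀ v ∈ s, G.Adj u v → c u ≠ c v := by
  classical
  induction s using Finset.strongInduction with
  | H s ih =>
  by_cases htri : (G.induce (s : Set V)).CliqueFree 3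
  · obtain ⟨c⟩ := hcol s htri
    refine ⟨fun v => if h : v ∈ s then c ⟨v, h⟩ else ⟨0, hn⟩, fun u hu v hv huv => ?_⟩
    simp only [hu, hv, dite_true]
    exact c.valid huv
  obtain ⟨T, hTs, hT, hTcard⟩ : ∃ T ⊆ s, G.IsClique (T : Set V) ∧ T.card = 3 := by
    simp only [CliqueFree, not_forall, not_not] at htri
    obtain ⟨t, ht⟩ := htri
    refine ⟨t.map (Function.Embedding.subtype _), ?_, ?_, by simpa using ht.card_eq⟩
    · intro x hx
      obtain ⟨y, -, rfl⟩ := Finset.mem_map.1 hx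
      exact y.2
    · intro x hx y hy hxy
      obtain ⟨x, hx', rfl⟩ := Finset.mem_map.1 hx
      obtain ⟨y, hy', rfl⟩ := Finset.mem_map.1 hy
      exact ht.isClique hx' hy' fun e => hxy (by rw [e])
  obtain ⟨K, hK, hKmax⟩ := Finset.exists_max_image
    (s.powerset.filter fun K : Finset V => G.IsClique (K : Set V)) Finset.card
    ⟨T, by simpa using ⟨hTs, hT⟩⟩
  simp only [Finset.mem_filter, Finset.mem_powerset] at hK hKmax
  obtain ⟨hKs, hK⟩ := hK
  have hcard : 2 < K.card := by
    have := hKmax T ⟨hTs, hT⟩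
    omega
  have hmax : ∀ v ∈ s, v ∉ K → ¬ ∀ c ∈ K, G.Adj v c := by
    intro v hv hvK hall
    have := hKmax (insert v K) ⟨Finset.insert_subset hv hKs, by
      rw [Finset.coe_insert]
      exact hK.insert fun b hb _ => hall b hb⟩
    rw [Finset.card_insert_of_notMem hvK] at this
    omega
  by_cases hout : ∀ v ∈ K, ∃ w ∈ s, w ∉ K ∧ G.Adj v w
  · obtain ⟨hadj, huniq⟩ := hGb.outer_neighbors hGd hK hcard hmax hout
    choose! f hfs hfK hf using hout
    obtain ⟨d, hd⟩ := ih (s \ K) (Finset.sdiff_ssubset hKs (Finset.card_pos.1 (by omega)))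
    obtain ⟨σ, hσ, -⟩ := K.exists_cycleOn
    have hσK : ∀ v ∈ K, σ v ∈ K := fun v hv => hσ.apply_mem_iff.2 hv
    have hσne : ∀ v ∈ K, σ v ≠ v := fun v hv =>
      hσ.apply_ne (Finset.one_lt_card_iff_nontrivial.1 (by omega)) hv
    have hd_f : ∀ u ∈ K, ∀ v ∈ K, u ≠ v → d (f u) ≠ d (f v) := fun u hu v hv huv =>
      hd _ (Finset.mem_sdiff.2 ⟨hfs u hu, hfK u hu⟩) _ (Finset.mem_sdiff.2 ⟨hfs v hv, hfK v hv⟩)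
        (hadj u hu v hv huv _ (hfs u hu) (hfK u hu) (hf u hu) _ (hfs v hv) (hfK v hv) (hf v hv))
    have hcross : ∀ u ∈ K, ∀ v ∈ s, v ∉ K → G.Adj u v → d (f (σ u)) ≠ d v := by
      intro u hu v hv hvK huv
      rw [huniq u hu v hv hvK huv _ (hfs u hu) (hfK u hu) (hf u hu)]
      exact hd_f _ (hσK u hu) _ hu (hσne u hu)
    refine ⟨fun v => if v ∈ K then d (f (σ v)) else d v, fun u hu v hv huv => ?_⟩
    by_cases huK : u ∈ K <;> by_cases hvK : v ∈ K <;> simp only [huK, hvK, if_true, if_false]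
    · exact hd_f _ (hσK u huK) _ (hσK v hvK) (σ.injective.ne huv.ne)
    · exact hcross u huK v hv hvK huv
    · exact (hcross v hvK u hu huK huv.symm).symm
    · exact hd _ (Finset.mem_sdiff.2 ⟨hu, huK⟩) _ (Finset.mem_sdiff.2 ⟨hv, hvK⟩) huv
  · push Not at hout
    obtain ⟨x, hx, hxout⟩ := hout
    obtain ⟨d, hd⟩ := ih (s.erase x) (Finset.erase_ssubset (hKs hx))
    obtain ⟨i, -, hi⟩ : ∃ i ∈ (Finset.univ : Finset (Fin n)), i ∉ (K.erase x).image d := by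
      refine Finset.exists_mem_notMem_of_card_lt_card ?_
      have h1 : ((K.erase x).image d).card ≤ (K.erase x).card := Finset.card_image_le
      have h2 := hclique K hK
      rw [Finset.card_erase_of_mem hx] at h1
      rw [Finset.card_fin]
      omega
    have hi' : ∀ v ∈ s, G.Adj x v → d v ≠ i := by
      rintro v hv hxv rfl
      refine hi (Finset.mem_image_of_mem d (Finset.mem_erase.2 ⟨hxv.ne', ?_⟩))
      by_contra hvK
      exact hxout v hv hvK hxv
    refine ⟨Function.update d x i, fun u hu v hv huv => ?_⟩
    by_cases hux : u = x
    · subst hux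
      simpa [huv.ne'] using (hi' v hv huv).symm
    by_cases hvx : v = x
    · subst hvx
      simpa [hux] using hi' u hu huv.symm
    simpa [hux, hvx] using
      hd u (Finset.mem_erase.2 ⟨hux, hu⟩) v (Finset.mem_erase.2 ⟨hvx, hv⟩) huv

theorem statement_1 {V : Type*} [Fintype V] (G : SimpleGraph V)
    (hGb : IsIndFree G bull) (hGd : IsIndFree G diamond) (k : ℕ) (hk : 0 < k)
    (hcol : ∀ s : Set V, (G.induce s).CliqueFree 3 → (G.induce s).Colorable k) :
    G.chromaticNumber ≤ (max (2 * k) G.cliqueNum : ℕ∞) := by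
  obtain ⟨c, hc⟩ := hGb.exists_coloring hGd (n := max (2 * k) G.cliqueNum) (by omega)
    (fun s hs => (hcol s hs).mono (by omega))
    (fun K hK => hK.card_le_cliqueNum.trans (le_max_right _ _)) Finset.univ
  have hG : G.Colorable (max (2 * k) G.cliqueNum) :=
    ⟨Coloring.mk c fun {u v} huv => hc u (Finset.mem_univ u) v (Finset.mem_univ v) huv⟩
  exact_mod_cast hG.chromaticNumber_le
end

section
/- Let G be a finite simple graph that is bull-free and diamond-free, and let a_0 − a_1 − a_2 − ⋯ − a_{k-1} − a_0 be an induced cycle in G of length k ≥ 5. Then for every i (indices taken modulo k), the vertices a_i and a_{i+1} have no common neighbour in G. -/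
open SimpleGraph

theorem IsIndFree.isEmpty_embedding {V W : Type*} {G : SimpleGraph V} {H : SimpleGraph W}
    (h : IsIndFree G H) : IsEmpty (H ↪g G) :=
  ⟨fun f => h (Set.range f)
    ⟨⟨Equiv.ofInjective f f.injective, f.map_adj_iff⟩⟩⟩

theorem IsIndFree.false_of_bull {V : Type*} {G : SimpleGraph V} (h : IsIndFree G bull)
    {x b c p q : V} (hxb : G.Adj x b) (hxc : G.Adj x c) (hbc : G.Adj b c)
    (hbp : G.Adj b p) (hcq : G.Adj c q) (hxp : ¬ G.Adj x p) (hxq : ¬ G.Adj x q)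
    (hbq : ¬ G.Adj b q) (hcp : ¬ G.Adj c p) (hpq : ¬ G.Adj p q) : False := by
  have hinj : Function.Injective ![x, b, c, p, q] := by
    intro u v huv
    fin_cases u <;> fin_cases v <;> simp at huv ⊢ <;> subst huv <;>
      simp_all [G.adj_comm]
  refine h.isEmpty_embedding.false ⟨⟨![x, b, c, p, q], hinj⟩, ?_⟩
  intro u v
  fin_cases u <;> fin_cases v <;> simp_all [bull, G.adj_comm]

theorem IsIndFree.false_of_diamond {V : Type*} {G : SimpleGraph V} (h : IsIndFree G diamond)
    {p q b c : V} (hpb : G.Adj p b) (hpc : G.Adj p c) (hqb : G.Adj q b) (hqc : G.Adj q c)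
    (hbc : G.Adj b c) (hne : p ≠ q) (hpq : ¬ G.Adj p q) : False := by
  have hinj : Function.Injective ![p, q, b, c] := by
    intro u v huv
    fin_cases u <;> fin_cases v <;> simp at huv ⊢ <;> subst huv <;>
      simp_all [G.adj_comm]
  refine h.isEmpty_embedding.false ⟨⟨![p, q, b, c], hinj⟩, ?_⟩
  intro u v
  fin_cases u <;> fin_cases v <;> simp_all [diamond, G.adj_comm]

theorem ZMod.natCast_ne_zero_of_pos_of_lt {k n : ℕ} (hn : 0 < n) (hnk : n < k) :
    (n : ZMod k) ≠ 0 := by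
  rw [Ne, ZMod.natCast_eq_zero_iff]
  exact Nat.not_dvd_of_pos_of_lt hn hnk

theorem statement_4 {V : Type*} [Fintype V] (G : SimpleGraph V)
    (hGb : IsIndFree G bull) (hGd : IsIndFree G diamond)
    (k : ℕ) (hk : 5 ≤ k) (a : ZMod k → V) (hinj : Function.Injective a)
    (hcyc : ∀ i j : ZMod k, G.Adj (a i) (a j) ↔ (j = i + 1 ∨ i = j + 1)) :
    ∀ (i : ZMod k) (x : V), ¬ (G.Adj x (a i) ∧ G.Adj x (a (i + 1))) := by
  rintro i x ⟨hx0, hx1⟩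
  have h1 : (1 : ZMod k) ≠ 0 := by
    exact_mod_cast ZMod.natCast_ne_zero_of_pos_of_lt (k := k) (n := 1) (by omega) (by omega)
  have h2 : (2 : ZMod k) ≠ 0 := by
    exact_mod_cast ZMod.natCast_ne_zero_of_pos_of_lt (k := k) (n := 2) (by omega) (by omega)
  have h3 : (3 : ZMod k) ≠ 0 := by
    exact_mod_cast ZMod.natCast_ne_zero_of_pos_of_lt (k := k) (n := 3) (by omega) (by omega)
  have h4 : (4 : ZMod k) ≠ 0 := by
    exact_mod_cast ZMod.natCast_ne_zero_of_pos_of_lt (k := k) (n := 4) (by omega) (by omega)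
  have adj_succ (j : ZMod k) : G.Adj (a j) (a (j + 1)) := (hcyc _ _).2 (Or.inl rfl)
  have not_adj_two (j : ZMod k) : ¬ G.Adj (a j) (a (j + 2)) := by
    rw [hcyc]
    rintro (h | h)
    · exact h1 (by linear_combination h)
    · exact h3 (by linear_combination -h)
  have not_adj_three (j : ZMod k) : ¬ G.Adj (a j) (a (j + 3)) := by
    rw [hcyc]
    rintro (h | h)
    · exact h2 (by linear_combination h)
    · exact h4 (by linear_combination -h)
  have ne_two (j : ZMod k) : a j ≠ a (j + 2) := fun h =>
    h2 (by linear_combination -(hinj h))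
  obtain ⟨j, rfl⟩ : ∃ j, i = j + 1 := ⟨i - 1, by ring⟩
  have e2 : j + 1 + 1 = j + 2 := by ring
  have e3 : j + 2 + 1 = j + 3 := by ring
  have e3' : j + 1 + 2 = j + 3 := by ring
  have a01 := adj_succ j
  have a12 := e2 ▸ adj_succ (j + 1)
  have a23 := e3 ▸ adj_succ (j + 2)
  have n13 := e3' ▸ not_adj_two (j + 1)
  have d13 := e3' ▸ ne_two (j + 1)
  rw [e2] at hx1
  have hxp : ¬ G.Adj x (a j) := fun h =>
    hGd.false_of_diamond a01 h.symm a12.symm hx1.symm hx0.symm (ne_two j) (not_adj_two j)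
  have hxq : ¬ G.Adj x (a (j + 3)) := fun h =>
    hGd.false_of_diamond a12 hx0.symm a23.symm h.symm hx1.symm d13 n13
  exact hGb.false_of_bull hx0 hx1 a12 a01.symm a23 hxp hxq n13
    (fun h => not_adj_two j h.symm) (not_adj_three j)
end

section
/- Let G be a finite simple graph that is P_5-free, bull-free and diamond-free. Then χ(G) ≤ max{3, ω(G)}. -/
open SimpleGraph

namespace SimpleGraph

universe u

variable {V : Type u} {G : SimpleGraph V} {m : ℕ}

/-- Elementwise form of being `P₅`-free. -/
def NoInducedPathFive (G : SimpleGraph V) : Prop :=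
  ∀ ⦃a b c d e : V⦄, G.Adj a b → G.Adj b c → G.Adj c d → G.Adj d e →
    ¬ G.Adj a c → ¬ G.Adj a d → ¬ G.Adj a e → ¬ G.Adj b d → ¬ G.Adj b e → ¬ G.Adj c e → False

/-- Elementwise form of being bull-free. -/
def NoInducedBull (G : SimpleGraph V) : Prop :=
  ∀ ⦃a b c d e : V⦄, G.Adj a b → G.Adj b c → G.Adj a c → G.Adj b d → G.Adj c e →
    ¬ G.Adj a d → ¬ G.Adj a e → ¬ G.Adj b e → ¬ G.Adj c d → ¬ G.Adj d e → False

/-- Elementwise form of being diamond-free. -/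
def NoInducedDiamond (G : SimpleGraph V) : Prop :=
  ∀ ⦃a b c d : V⦄, G.Adj a c → G.Adj a d → G.Adj b c → G.Adj b d → G.Adj c d →
    a ≠ b → G.Adj a b

theorem _root_.IsIndFree.isEmpty_embedding_s6 {W : Type*} {H : SimpleGraph W}
    (h : IsIndFree G H) : IsEmpty (H ↪g G) :=
  ⟨fun f => h (Set.range f) ⟨f.isoInduceRange⟩⟩

theorem _root_.IsIndFree.noInducedPathFive (h : IsIndFree G (pathGraph 5)) :
    G.NoInducedPathFive := by
  intro a b c d e hab hbc hcd hde hac had hae hbd hbe hce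
  have key : ∀ i j, G.Adj (![a, b, c, d, e] i) (![a, b, c, d, e] j) ↔ (pathGraph 5).Adj i j := by
    intro i j
    fin_cases i <;> fin_cases j <;> simp [pathGraph_adj, *, G.adj_comm]
  refine h.isEmpty_embedding_s6.false ⟨⟨![a, b, c, d, e], ?_⟩, key _ _⟩
  intro i j hij
  have hk : ∀ k, (pathGraph 5).Adj i k ↔ (pathGraph 5).Adj j k := fun k => by
    rw [← key, ← key, hij]
  simp only [pathGraph_adj] at hk
  clear hij
  revert i j
  decide

theorem _root_.IsIndFree.noInducedBull (h : IsIndFree G bull) : G.NoInducedBull := by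
  intro a b c d e hab hbc hac hbd hce had hae hbe hcd hde
  have key : ∀ i j, G.Adj (![a, b, c, d, e] i) (![a, b, c, d, e] j) ↔ bull.Adj i j := by
    intro i j
    fin_cases i <;> fin_cases j <;> simp [bull, *, G.adj_comm]
  refine h.isEmpty_embedding_s6.false ⟨⟨![a, b, c, d, e], ?_⟩, key _ _⟩
  intro i j hij
  have hk : ∀ k, bull.Adj i k ↔ bull.Adj j k := fun k => by
    rw [← key, ← key, hij]
  simp only [bull, fromEdgeSet_adj, Set.mem_insert_iff, Set.mem_singleton_iff] at hk
  clear hij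
  revert i j
  decide

theorem _root_.IsIndFree.noInducedDiamond (h : IsIndFree G diamond) : G.NoInducedDiamond := by
  intro a b c d hac had hbc hbd hcd hne
  by_contra hab
  have key : ∀ i j, G.Adj (![a, b, c, d] i) (![a, b, c, d] j) ↔ diamond.Adj i j := by
    intro i j
    fin_cases i <;> fin_cases j <;> simp [diamond, *, G.adj_comm]
  refine h.isEmpty_embedding_s6.false ⟨⟨![a, b, c, d], ?_⟩, key _ _⟩
  have := hac.ne
  have := had.ne
  have := hbc.ne
  have := hbd.ne
  have := hcd.ne
  intro i j hij
  fin_cases i <;> fin_cases j <;> simp_all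

/-- Every proper induced subgraph of `G` is `m`-colorable. -/
def ProperInduceColorable (G : SimpleGraph V) (m : ℕ) : Prop :=
  ∀ s : Set V, s ≠ Set.univ → (G.induce s).Colorable m

/-- A coloring of a nonempty union of connected components suffices. -/
theorem ProperInduceColorable.colorable_of_closed (hG : G.ProperInduceColorable m) {T : Set V}
    (hT : T.Nonempty) (hclosed : ∀ x ∈ T, ∀ y, G.Adj x y → y ∈ T) (c : V → Fin m)
    (hc : ∀ x ∈ T, ∀ y ∈ T, G.Adj x y → c x ≠ c y) : G.Colorable m := by
  classical
  obtain ⟨C⟩ := hG Tᶜ (by simpa using hT.ne_empty)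
  refine ⟨Coloring.mk (fun x => if h : x ∈ T then c x else C ⟨x, h⟩) ?_⟩
  intro x y hxy
  by_cases hx : x ∈ T
  · have hy := hclosed x hx y hxy
    simpa [hx, hy] using hc x hx y hy hxy
  · have hy : y ∉ T := fun hy => hx (hclosed y hy x hxy.symm)
    simp only [hx, hy, dite_false]
    exact C.valid (by simpa using hxy)

/-- A vertex with fewer than `m` neighbors can always be colored last. -/
theorem ProperInduceColorable.le_card_of_neighbors (hG : G.ProperInduceColorable m)
    (hn : ¬ G.Colorable m) {v : V} {s : Finset V} (hs : ∀ x, G.Adj v x → x ∈ s) :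
    m ≤ s.card := by
  classical
  by_contra! hlt
  obtain ⟨C⟩ := hG {v}ᶜ (by simp)
  have : NeZero m := ⟨by omega⟩
  let c : V → Fin m := fun x => if h : x = v then 0 else C ⟨x, h⟩
  obtain ⟨k, hk⟩ : ∃ k, k ∉ s.image c := by
    by_contra! hall
    have h1 := Finset.card_le_card (fun k _ => hall k : Finset.univ ⊆ s.image c)
    have h2 := Finset.card_image_le (s := s) (f := c)
    simp at h1
    omega
  have hk' : ∀ x, G.Adj v x → c x ≠ k := fun x hx he =>
    hk (Finset.mem_image.2 ⟨x, hs x hx, he⟩)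
  refine hn ⟨Coloring.mk (fun x => if x = v then k else c x) ?_⟩
  intro x y hxy
  by_cases hx : x = v <;> by_cases hy : y = v
  · subst hx hy
    exact absurd hxy (G.loopless.irrefl _)
  · subst hx
    simpa [hy] using (hk' y hxy).symm
  · subst hy
    simpa [hx] using hk' x hxy.symm
  · simp only [hx, hy, if_false, c, dite_false]
    exact C.valid (by simpa using hxy)

/-- In a diamond-free graph, a vertex outside a maximum clique has at most one neighbor in it. -/
theorem NoInducedDiamond.eq_of_adj_maximumClique (hd : G.NoInducedDiamond) {K : Finset V}
    (hK : G.IsClique K) (hmax : ∀ L : Finset V, G.IsClique L → L.card ≤ K.card)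
    {x u v : V} (hx : x ∉ K) (hu : u ∈ K) (hv : v ∈ K) (hxu : G.Adj x u) (hxv : G.Adj x v) :
    u = v := by
  classical
  by_contra huv
  have hall : ∀ w ∈ K, G.Adj x w := by
    intro w hw
    by_cases hwu : w = u
    · exact hwu ▸ hxu
    by_cases hwv : w = v
    · exact hwv ▸ hxv
    exact hd hxu hxv (hK hw hu hwu) (hK hw hv hwv) (hK hu hv huv) (fun h => hx (h ▸ hw))
  have := hmax (insert x K) (by
    rw [Finset.coe_insert]
    exact hK.insert fun b hb _ => hall b hb)
  rw [Finset.card_insert_of_notMem hx] at this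
  omega

/-- Neighbors outside a maximum clique, attached at distinct vertices, are adjacent. -/
theorem NoInducedBull.adj_of_adj_maximumClique (hb : G.NoInducedBull) (hd : G.NoInducedDiamond)
    {K : Finset V} (hK : G.IsClique K) (hmax : ∀ L : Finset V, G.IsClique L → L.card ≤ K.card)
    (hcard : 3 ≤ K.card) {x y u v : V} (hx : x ∉ K) (hy : y ∉ K) (hu : u ∈ K) (hv : v ∈ K)
    (hux : G.Adj u x) (hvy : G.Adj v y) (huv : u ≠ v) : G.Adj x y := by
  classical
  by_contra hxy
  obtain ⟨w, hw, hwuv⟩ := Finset.exists_mem_notMem_of_card_lt_card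
    (s := {u, v}) (t := K) (Finset.card_le_two.trans_lt (by omega))
  simp only [Finset.mem_insert, Finset.mem_singleton, not_or] at hwuv
  have h : ∀ {z p q}, z ∉ K → p ∈ K → q ∈ K → G.Adj p z → p ≠ q → ¬ G.Adj q z :=
    fun hz hp hq hpz hpq hqz =>
      hpq (hd.eq_of_adj_maximumClique hK hmax hz hp hq hpz.symm hqz.symm)
  exact hb (hK hw hu hwuv.1) (hK hu hv huv) (hK hw hv hwuv.2) hux hvy
    (h hx hu hw hux (Ne.symm hwuv.1)) (h hy hv hw hvy (Ne.symm hwuv.2))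
    (h hy hv hu hvy huv.symm) (h hx hu hv hux huv) hxy

/-- If every vertex of a maximum clique has a neighbor outside it, that neighbor is unique. -/
theorem NoInducedBull.eq_of_adj_maximumClique (hb : G.NoInducedBull) (hd : G.NoInducedDiamond)
    {K : Finset V} (hK : G.IsClique K) (hmax : ∀ L : Finset V, G.IsClique L → L.card ≤ K.card)
    (hcard : 3 ≤ K.card) (hout : ∀ v ∈ K, ∃ y, y ∉ K ∧ G.Adj v y) {x y u : V} (hx : x ∉ K)
    (hy : y ∉ K) (hu : u ∈ K) (hux : G.Adj u x) (huy : G.Adj u y) : x = y := by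
  classical
  by_contra hxy
  obtain ⟨v, hv, hvu⟩ := Finset.exists_mem_notMem_of_card_lt_card
    (s := {u}) (t := K) (by simp; omega)
  obtain ⟨w, hw, hwuv⟩ := Finset.exists_mem_notMem_of_card_lt_card
    (s := {u, v}) (t := K) (Finset.card_le_two.trans_lt (by omega))
  simp only [Finset.mem_insert, Finset.mem_singleton, not_or] at hwuv hvu
  obtain ⟨e, he, hve⟩ := hout v hv
  obtain ⟨f, hf, hwf⟩ := hout w hw
  have adj : ∀ {x y u v}, x ∉ K → y ∉ K → u ∈ K → v ∈ K → G.Adj u x → G.Adj v y → u ≠ v →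
      G.Adj x y := hb.adj_of_adj_maximumClique hd hK hmax hcard
  have hxe := adj hx he hu hv hux hve (Ne.symm hvu)
  have hye := adj hy he hu hv huy hve (Ne.symm hvu)
  have hxf := adj hx hf hu hw hux hwf (Ne.symm hwuv.1)
  have hyf := adj hy hf hu hw huy hwf (Ne.symm hwuv.1)
  have hef := adj he hf hv hw hve hwf (Ne.symm hwuv.2)
  have hue := hd hux huy hxe.symm hye.symm (hd hxe hxf hye hyf hef hxy) (fun h => he (h ▸ hu))
  exact hvu (hd.eq_of_adj_maximumClique hK hmax he hv hu hve.symm hue.symm)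

/-- A maximum clique with at least three vertices lies in an easily colored component. -/
theorem ProperInduceColorable.colorable_of_maximumClique (hG : G.ProperInduceColorable m)
    (hb : G.NoInducedBull) (hd : G.NoInducedDiamond) (hm : 3 ≤ m) {K : Finset V}
    (hK : G.IsClique K) (hmax : ∀ L : Finset V, G.IsClique L → L.card ≤ K.card)
    (hcard : 3 ≤ K.card) (hKm : K.card ≤ m) : G.Colorable m := by
  classical
  by_contra hn
  have hout : ∀ L : Finset V, G.IsClique L → L.card = K.card → ∀ v ∈ L, ∃ y, y ∉ L ∧ G.Adj v y := by
    intro L hL hLK v hv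
    by_contra! h
    have := hG.le_card_of_neighbors hn (v := v) (s := L.erase v) (fun x hx =>
      Finset.mem_erase.2 ⟨hx.ne', by_contra fun hxL => h x hxL hx⟩)
    rw [Finset.card_erase_of_mem hv] at this
    omega
  have hn' : ∀ v, ∃ y, v ∈ K → y ∉ K ∧ G.Adj v y := fun v => by
    by_cases hv : v ∈ K
    · obtain ⟨y, hy⟩ := hout K hK rfl v hv
      exact ⟨y, fun _ => hy⟩
    · exact ⟨v, fun h => absurd h hv⟩
  choose n hnK using hn'
  have hnot : ∀ v ∈ K, n v ∉ K := fun v hv => (hnK v hv).1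
  have hadj : ∀ v ∈ K, G.Adj v (n v) := fun v hv => (hnK v hv).2
  have hcross : ∀ u ∈ K, ∀ v ∈ K, G.Adj u (n v) → u = v := fun u hu v hv h =>
    hd.eq_of_adj_maximumClique hK hmax (hnot v hv) hu hv h.symm (hadj v hv).symm
  have hinj : Set.InjOn n K := fun u hu v hv h => hcross u hu v hv (h ▸ hadj u hu)
  let M := K.image n
  have hM : G.IsClique M := by
    intro x hx y hy hxy
    obtain ⟨u, hu, rfl⟩ := Finset.mem_image.1 hx
    obtain ⟨v, hv, rfl⟩ := Finset.mem_image.1 hy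
    exact hb.adj_of_adj_maximumClique hd hK hmax hcard (hnot u hu) (hnot v hv) hu hv
      (hadj u hu) (hadj v hv) (fun h => hxy (h ▸ rfl))
  have hMK : M.card = K.card := Finset.card_image_of_injOn hinj
  have hmem : ∀ v ∈ K, n v ∈ M := fun v hv => Finset.mem_image_of_mem n hv
  have hKM : ∀ v ∈ K, v ∉ M := by
    intro v hv h
    obtain ⟨u, hu, rfl⟩ := Finset.mem_image.1 h
    exact hnot u hu hv
  have : NeZero m := ⟨by omega⟩
  obtain ⟨g, hg⟩ : ∃ g : V → Fin m, Set.InjOn g K := by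
    refine ⟨fun x => if h : x ∈ K then Fin.castLE hKm (K.equivFin ⟨x, h⟩) else 0, ?_⟩
    intro x hx y hy hxy
    have hx' : x ∈ K := hx
    have hy' : y ∈ K := hy
    simpa [hx', hy'] using hxy
  have h01 : ∀ k : Fin m, k ≠ k + 1 := by
    intro k h
    have h1 : (1 : Fin m) = 0 := by simpa using h.symm
    have := congrArg Fin.val h1
    rw [Fin.val_one', Nat.mod_eq_of_lt (by omega)] at this
    simp at this
  obtain ⟨v₀, hv₀⟩ := Finset.card_pos.1 (by omega : 0 < K.card)
  have : Nonempty V := ⟨v₀⟩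
  let c : V → Fin m := fun x => if x ∈ K then g x else g (Function.invFunOn n K x) + 1
  have hcK : ∀ v ∈ K, c v = g v := fun v hv => if_pos hv
  have hcM : ∀ v ∈ K, c (n v) = g v + 1 := fun v hv => by
    simp only [c, if_neg (hnot v hv)]
    rw [hinj.leftInvOn_invFunOn hv]
  refine hn (hG.colorable_of_closed (T := {x | x ∈ K ∨ x ∈ M}) ?_ ?_ c ?_)
  · exact ⟨v₀, Or.inl hv₀⟩
  · rintro x (hx | hx) y hxy
    · by_cases hy : y ∈ K
      · exact Or.inl hy
      · rw [← hb.eq_of_adj_maximumClique hd hK hmax hcard (hout K hK rfl) (hnot x hx) hy hx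
          (hadj x hx) hxy]
        exact Or.inr (hmem x hx)
    · by_cases hy : y ∈ M
      · exact Or.inr hy
      · obtain ⟨u, hu, rfl⟩ := Finset.mem_image.1 hx
        rw [← hb.eq_of_adj_maximumClique hd hM (hMK.symm ▸ hmax) (hMK.symm ▸ hcard)
          (hout M hM hMK) (hKM u hu) hy hx (hadj u hu).symm hxy]
        exact Or.inl hu
  · rintro x (hx | hx) y (hy | hy) hxy
    · rw [hcK x hx, hcK y hy]
      exact fun h => hxy.ne (hg hx hy h)
    · obtain ⟨v, hv, rfl⟩ := Finset.mem_image.1 hy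
      obtain rfl := hcross x hx v hv hxy
      rw [hcK x hx, hcM x hx]
      exact h01 _
    · obtain ⟨v, hv, rfl⟩ := Finset.mem_image.1 hx
      obtain rfl := hcross y hy v hv hxy.symm
      rw [hcK y hy, hcM y hy]
      exact (h01 _).symm
    · obtain ⟨u, hu, rfl⟩ := Finset.mem_image.1 hx
      obtain ⟨v, hv, rfl⟩ := Finset.mem_image.1 hy
      rw [hcM u hu, hcM v hv]
      intro h
      exact hxy.ne (by rw [hg hu hv (add_right_cancel h)])

/-- In the triangle-free case, the component of an induced `C₅` is a blow-up of `C₅`. -/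
theorem ProperInduceColorable.colorable_of_cycleFive (hG : G.ProperInduceColorable m)
    (hp : G.NoInducedPathFive) (hm : 3 ≤ m)
    (htri : ∀ a b c, G.Adj a b → G.Adj b c → ¬ G.Adj a c) {f : Fin 5 → V}
    (hf : ∀ i, G.Adj (f i) (f (i + 1))) (hnf : ∀ i, ¬ G.Adj (f i) (f (i + 2))) :
    G.Colorable m := by
  have e5 : ∀ i : Fin 5, i + 1 + 1 = i + 2 ∧ i + 2 + 1 = i + 3 ∧ i + 3 + 1 = i + 4 ∧
      i + 4 + 1 = i ∧ i + 1 + 2 = i + 3 ∧ i + 2 + 2 = i + 4 ∧ i + 3 + 2 = i := by decide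
  let T : Set V := {x | ∃ i, G.Adj x (f i) ∧ G.Adj x (f (i + 2))}
  have hnbr : ∀ y i, G.Adj y (f i) → y ∈ T := by
    intro y i hy
    obtain ⟨h11, h21, h31, h41, h12, h22, h32⟩ := e5 i
    by_contra hyT
    refine hp hy (hf i) (h11 ▸ hf (i + 1)) (h21 ▸ hf (i + 2)) (htri _ _ _ hy (hf i))
      (fun h => hyT ⟨i, hy, h⟩) (fun h => hyT ⟨i + 3, h, h32.symm ▸ hy⟩) (hnf i)
      (fun h => hnf (i + 3) (h32.symm ▸ h.symm)) (h12 ▸ hnf (i + 1))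
  have hclosed : ∀ x ∈ T, ∀ y, G.Adj x y → y ∈ T := by
    rintro x ⟨i, hxi, hxi2⟩ y hxy
    obtain ⟨h11, h21, h31, h41, h12, h22, h32⟩ := e5 i
    by_contra hyT
    have hy : ∀ j, ¬ G.Adj y (f j) := fun j h => hyT (hnbr y j h)
    have hi4 : G.Adj (f (i + 4)) (f i) := by simpa only [h41] using hf (i + 4)
    exact hp hxy.symm hxi2 (h21 ▸ hf (i + 2)) (h31 ▸ hf (i + 3)) (hy _) (hy _) (hy _)
      (htri _ _ _ hxi2 (h21 ▸ hf (i + 2))) (htri _ _ _ hxi hi4.symm) (h22 ▸ hnf (i + 2))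
  have hidx : ∀ x, ∃ i, x ∈ T → G.Adj x (f i) ∧ G.Adj x (f (i + 2)) := fun x => by
    by_cases hx : x ∈ T
    · exact hx.imp fun i hi _ => hi
    · exact ⟨0, fun h => absurd h hx⟩
  choose idx hidx using hidx
  have hcol : ∀ i j : Fin 5, i ≠ j → i ≠ j + 2 → i + 2 ≠ j →
      (![0, 1, 0, 1, 2] : Fin 5 → Fin 3) i ≠ (![0, 1, 0, 1, 2] : Fin 5 → Fin 3) j := by decide
  refine hG.colorable_of_closed ⟨f 0, hnbr _ _ (hf 0)⟩ hclosed
    (fun x => Fin.castLE hm ((![0, 1, 0, 1, 2] : Fin 5 → Fin 3) (idx x))) ?_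
  intro x hx y hy hxy h
  obtain ⟨hx1, hx2⟩ := hidx x hx
  obtain ⟨hy1, hy2⟩ := hidx y hy
  refine hcol (idx x) (idx y) ?_ ?_ ?_ (Fin.castLE_injective hm h)
  · intro he
    exact htri _ _ _ hxy hy1 (he ▸ hx1)
  · intro he
    exact htri _ _ _ hxy hy2 (he ▸ hx1)
  · intro he
    exact htri _ _ _ hxy hy1 (he ▸ hx2)

/-- Without an induced `C₅`, the component of any vertex is bipartite. -/
theorem ProperInduceColorable.colorable_of_triangleFree (hG : G.ProperInduceColorable m)
    (hp : G.NoInducedPathFive) (hm : 3 ≤ m)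
    (htri : ∀ a b c, G.Adj a b → G.Adj b c → ¬ G.Adj a c) : G.Colorable m := by
  classical
  by_contra hn
  have hC5 : ∀ f : Fin 5 → V, (∀ i, G.Adj (f i) (f (i + 1))) →
      ¬ ∀ i, ¬ G.Adj (f i) (f (i + 2)) := fun f h1 h2 =>
    hn (hG.colorable_of_cycleFive hp hm htri h1 h2)
  rcases isEmpty_or_nonempty V with hV | ⟨⟨v⟩⟩
  · exact hn (Colorable.of_isEmpty m)
  let B : V → Prop := fun x => x ≠ v ∧ ¬ G.Adj v x ∧ ∃ a, G.Adj v a ∧ G.Adj a x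
  let C : V → Prop := fun x => x ≠ v ∧ ¬ G.Adj v x ∧ ¬ B x ∧ ∃ b, B b ∧ G.Adj b x
  have hCpath : ∀ x y, C x → G.Adj x y → y ≠ v → ¬ G.Adj v y → ¬ B y →
      ∃ b, B b ∧ G.Adj b x ∧ G.Adj b y := by
    rintro x y ⟨hxv, hvx, hxB, b, ⟨hbv, hvb, a, hva, hab⟩, hbx⟩ hxy hyv hvy hyB
    by_contra! h
    exact hp hxy.symm hbx.symm hab.symm hva.symm
      (fun hyb => h b ⟨hbv, hvb, a, hva, hab⟩ hbx hyb.symm)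
      (fun hya => hyB ⟨hyv, hvy, a, hva, hya.symm⟩) (fun h => hvy h.symm)
      (fun hxa => hxB ⟨hxv, hvx, a, hva, hxa.symm⟩) (fun h => hvx h.symm) (fun h => hvb h.symm)
  have hBB : ∀ x y, B x → B y → ¬ G.Adj x y := by
    rintro x y ⟨hxv, hvx, a, hva, hax⟩ ⟨hyv, hvy, b, hvb, hby⟩ hxy
    refine hC5 ![v, a, x, y, b] ?_ ?_
    · intro i
      fin_cases i
      exacts [hva, hax, hxy, hby.symm, hvb.symm]
    · intro i
      fin_cases i
      exacts [hvx, htri _ _ _ hax hxy, htri _ _ _ hxy hby.symm, fun h => hvy h.symm,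
        htri _ _ _ hvb.symm hva]
  refine hn (hG.colorable_of_closed (T := {x | x = v ∨ G.Adj v x ∨ B x ∨ C x}) ⟨v, Or.inl rfl⟩ ?_
    (fun x => if x = v ∨ B x then ⟨0, by omega⟩ else ⟨1, by omega⟩) ?_)
  · intro x hx y hxy
    by_contra hy
    simp only [Set.mem_ofPred_eq, not_or] at hx hy
    obtain ⟨hyv, hvy, hyB, hyC⟩ := hy
    rcases hx with rfl | hx | hx | hx
    · exact hvy hxy
    · exact hyB ⟨hyv, hvy, x, hx, hxy⟩
    · exact hyC ⟨hyv, hvy, hyB, x, hx, hxy⟩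
    · obtain ⟨b, hb, -, hby⟩ := hCpath x y hx hxy hyv hvy hyB
      exact hyC ⟨hyv, hvy, hyB, b, hb, hby⟩
  · intro x hx y hy hxy
    by_cases hx0 : x = v ∨ B x <;> by_cases hy0 : y = v ∨ B y
    · exfalso
      rcases hx0 with rfl | hx0 <;> rcases hy0 with rfl | hy0
      · exact hxy.ne rfl
      · exact hy0.2.1 hxy
      · exact hx0.2.1 hxy.symm
      · exact hBB x y hx0 hy0 hxy
    · simp [hx0, hy0]
    · simp [hx0, hy0]
    · exfalso
      simp only [not_or] at hx0 hy0
      have hx' : G.Adj v x ∨ C x := by simpa [hx0] using hx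
      have hy' : G.Adj v y ∨ C y := by simpa [hy0] using hy
      rcases hx' with hx' | hx' <;> rcases hy' with hy' | hy'
      · exact htri _ _ _ hx' hxy hy'
      · exact hy0.2 ⟨hy'.1, hy'.2.1, x, hx', hxy⟩
      · exact hx0.2 ⟨hx'.1, hx'.2.1, y, hy', hxy.symm⟩
      · obtain ⟨b, -, hbx, hby⟩ := hCpath x y hx' hxy hy'.1 hy'.2.1 hy'.2.2.1
        exact htri _ _ _ hbx hxy hby

theorem colorable_of_noInducedPathFive_bull_diamond (hm : 3 ≤ m) (N : ℕ) :
    ∀ (V : Type u) [Fintype V] (G : SimpleGraph V), Fintype.card V = N →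
      G.NoInducedPathFive → G.NoInducedBull → G.NoInducedDiamond →
      (∀ K : Finset V, G.IsClique K → K.card ≤ m) → G.Colorable m := by
  classical
  induction N using Nat.strong_induction_on with
  | _ N ih =>
    intro V _ G hN hp hb hd hω
    have hG : G.ProperInduceColorable m := by
      intro s hs
      refine ih _ ?_ s (G.induce s) rfl (fun a b c d e => @hp a b c d e)
        (fun a b c d e => @hb a b c d e)
        (fun a b c d h1 h2 h3 h4 h5 h6 => hd h1 h2 h3 h4 h5 (fun h => h6 (Subtype.ext h))) ?_
      · obtain ⟨x, hx⟩ := (Set.ne_univ_iff_exists_notMem s).1 hs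
        exact hN ▸ Fintype.card_subtype_lt hx
      · intro K hK
        rw [← Finset.card_map (Function.Embedding.subtype (· ∈ s))]
        refine hω _ ?_
        intro x hx y hy hxy
        simp only [Finset.coe_map, Set.mem_image, Finset.mem_coe] at hx hy
        obtain ⟨x, hx, rfl⟩ := hx
        obtain ⟨y, hy, rfl⟩ := hy
        exact hK hx hy (fun h => hxy (h ▸ rfl))
    by_cases htri : ∀ a b c, G.Adj a b → G.Adj b c → ¬ G.Adj a c
    · exact hG.colorable_of_triangleFree hp hm htri
    · push Not at htri
      obtain ⟨a, b, c, hab, hbc, hac⟩ := htri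
      obtain ⟨K, hK⟩ := G.exists_isNClique_cliqueNum
      have hmax : ∀ L : Finset V, G.IsClique L → L.card ≤ K.card := fun L hL =>
        hK.card_eq ▸ hL.card_le_cliqueNum
      have h3 : G.IsNClique 3 {a, b, c} := is3Clique_triple_iff.2 ⟨hab, hac, hbc⟩
      exact hG.colorable_of_maximumClique hb hd hm hK.isClique hmax
        (h3.card_eq ▸ hmax _ h3.isClique) (hω K hK.isClique)

end SimpleGraph

theorem statement_6 {V : Type*} [Fintype V] (G : SimpleGraph V)
    (hGp : IsIndFree G (pathGraph 5)) (hGb : IsIndFree G bull)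
    (hGd : IsIndFree G diamond) :
    G.chromaticNumber ≤ (max 3 G.cliqueNum : ℕ∞) := by
  have h := (colorable_of_noInducedPathFive_bull_diamond (m := max 3 G.cliqueNum)
    (le_max_left _ _) _ V G rfl hGp.noInducedPathFive hGb.noInducedBull hGd.noInducedDiamond
    (fun K hK => hK.card_le_cliqueNum.trans (le_max_right _ _))).chromaticNumber_le
  exact_mod_cast h
end

section
/- Let G be a finite simple graph that is P_6-free, bull-free and diamond-free, and suppose ω(G) > 3. Then G is ω(G)-colorable, i.e., χ(G) ≤ ω(G). -/
open SimpleGraph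

/-- A map that reflects and preserves adjacency on ordered pairs of distinct indices exhibits
an induced copy of `H`. -/
lemma IsIndFree.false_of_map {V : Type*} {n : ℕ} {G : SimpleGraph V} {H : SimpleGraph (Fin n)}
    (h : IsIndFree G H) (f : Fin n → V)
    (hf : ∀ i j, i < j → f i ≠ f j ∧ (H.Adj i j ↔ G.Adj (f i) (f j))) : False := by
  have hinj : Function.Injective f := by
    intro i j hij
    rcases lt_trichotomy i j with h1 | h1 | h1
    · exact absurd hij (hf i j h1).1
    · exact h1
    · exact absurd hij.symm (hf j i h1).1
  refine h (Set.range f) ⟨⟨Equiv.ofInjective f hinj, ?_⟩⟩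
  intro i j
  change G.Adj (f i) (f j) ↔ H.Adj i j
  rcases lt_trichotomy i j with h1 | h1 | h1
  · exact (hf i j h1).2.symm
  · subst h1
    simp
  · rw [G.adj_comm, H.adj_comm]
    exact (hf j i h1).2.symm

lemma IsIndFree.no_diamond {V : Type*} {G : SimpleGraph V} (h : IsIndFree G diamond)
    {p q r s : V} (hpq : p ≠ q) (npq : ¬ G.Adj p q) (hpr : G.Adj p r) (hps : G.Adj p s)
    (hqr : G.Adj q r) (hqs : G.Adj q s) (hrs : G.Adj r s) : False := by
  refine h.false_of_map ![p, q, r, s] ?_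
  simp [Fin.forall_fin_succ, diamond, *, hpr.ne, hps.ne, hqr.ne, hqs.ne, hrs.ne]

lemma IsIndFree.no_bull {V : Type*} {G : SimpleGraph V} (h : IsIndFree G bull)
    {a b c x y : V} (hab : G.Adj a b) (hac : G.Adj a c) (hbc : G.Adj b c)
    (hax : G.Adj a x) (hby : G.Adj b y) (nay : ¬ G.Adj a y) (nbx : ¬ G.Adj b x)
    (ncx : ¬ G.Adj c x) (ncy : ¬ G.Adj c y) : G.Adj x y := by
  by_contra nxy
  have hxy : x ≠ y := by
    rintro rfl
    exact nay hax
  have hcx : c ≠ x := by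
    rintro rfl
    exact nbx hbc
  have hcy : c ≠ y := by
    rintro rfl
    exact nay hac
  have hay : a ≠ y := by
    rintro rfl
    exact ncy hac.symm
  have hbx : b ≠ x := by
    rintro rfl
    exact ncx hbc.symm
  refine h.false_of_map ![c, a, b, x, y] ?_
  simp [Fin.forall_fin_succ, bull, *, hab.ne, hac.ne', hbc.ne', hax.ne, hby.ne,
    hac.symm, hbc.symm]

namespace SimpleGraph

variable {V : Type*} {G : SimpleGraph V} {S T U : Finset V} {n : ℕ}

/-- The subgraph of `G` induced by `S` has a proper colouring with the colours below `n`. -/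
def ColorableOn (G : SimpleGraph V) (S : Finset V) (n : ℕ) : Prop :=
  ∃ c : V → ℕ, (∀ x ∈ S, c x < n) ∧ ∀ x ∈ S, ∀ y ∈ S, G.Adj x y → c x ≠ c y

/-- Every partition of `S` into two nonempty parts is crossed by an edge. -/
def CutConnected (G : SimpleGraph V) (S : Finset V) : Prop :=
  ∀ T ⊆ S, T.Nonempty → T ≠ S → ∃ x ∈ T, ∃ y ∈ S, y ∉ T ∧ G.Adj x y

lemma ColorableOn.mono {m : ℕ} (h : G.ColorableOn S n) (hnm : n ≤ m) : G.ColorableOn S m := by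
  obtain ⟨c, hc, hc'⟩ := h
  exact ⟨c, fun x hx => (hc x hx).trans_le hnm, hc'⟩

lemma colorableOn_empty : G.ColorableOn ∅ n := ⟨fun _ => 0, by simp, by simp⟩

lemma nonempty_of_not_colorableOn (h : ¬ G.ColorableOn S n) : S.Nonempty := by
  rw [Finset.nonempty_iff_ne_empty]
  rintro rfl
  exact h colorableOn_empty

lemma exists_cutConnected_not_colorableOn (h : ¬ G.ColorableOn S n) :
    ∃ C ⊆ S, ¬ G.ColorableOn C n ∧ G.CutConnected C ∧
      ∀ x ∈ C, ∀ y ∈ S, G.Adj x y → y ∈ C := by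
  classical
  induction S using Finset.strongInduction with
  | H S ih =>
    by_cases hS : G.CutConnected S
    · exact ⟨S, subset_rfl, h, hS, fun _ _ y hy _ => hy⟩
    have hS' := hS
    unfold CutConnected at hS'
    push Not at hS'
    obtain ⟨T, hTS, hT, hne, hcut⟩ := hS'
    have hssT : T ⊂ S := lt_of_le_of_ne hTS hne
    have hssD : S \ T ⊂ S := Finset.sdiff_ssubset hTS hT
    by_cases h1 : G.ColorableOn T n
    · by_cases h2 : G.ColorableOn (S \ T) n
      · exfalso
        apply h
        obtain ⟨c, hc, hc'⟩ := h1
        obtain ⟨d, hd, hd'⟩ := h2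
        refine ⟨fun x => if x ∈ T then c x else d x, ?_, ?_⟩
        · intro x hx
          by_cases hxT : x ∈ T
          · simpa [hxT] using hc x hxT
          · simpa [hxT] using hd x (by simp [hx, hxT])
        · intro x hx y hy hxy
          by_cases hxT : x ∈ T <;> by_cases hyT : y ∈ T
          · simpa [hxT, hyT] using hc' x hxT y hyT hxy
          · exact absurd hxy (hcut x hxT y hy hyT)
          · exact absurd hxy.symm (hcut y hyT x hx hxT)
          · simpa [hxT, hyT] using hd' x (by simp [hx, hxT]) y (by simp [hy, hyT]) hxy
      · obtain ⟨C, hCS, hC, hCc, hcl⟩ := ih _ hssD h2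
        refine ⟨C, hCS.trans hssD.1, hC, hCc, fun x hx y hy hxy => ?_⟩
        have hxD := Finset.mem_sdiff.1 (hCS hx)
        refine hcl x hx y (Finset.mem_sdiff.2 ⟨hy, fun hyT => ?_⟩) hxy
        exact hcut y hyT x hxD.1 hxD.2 hxy.symm
    · obtain ⟨C, hCS, hC, hCc, hcl⟩ := ih _ hssT h1
      refine ⟨C, hCS.trans hTS, hC, hCc, fun x hx y hy hxy => ?_⟩
      refine hcl x hx y ?_ hxy
      by_contra hyT
      exact hcut x (hCS hx) y hy hyT hxy

/-- Deleting an independent set lowers the number of colours by at most one. -/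
lemma ColorableOn.succ_of_sdiff [DecidableEq V] (h : G.ColorableOn (S \ T) n)
    (hT : ∀ x ∈ T, ∀ y ∈ T, ¬ G.Adj x y) : G.ColorableOn S (n + 1) := by
  obtain ⟨c, hc, hc'⟩ := h
  refine ⟨fun x => if x ∈ T then n else c x, ?_, ?_⟩
  · intro x hx
    by_cases hxT : x ∈ T
    · simp [hxT]
    · simpa [hxT] using (hc x (by simp [hx, hxT])).trans (Nat.lt_succ_self n)
  · intro x hx y hy hxy
    by_cases hxT : x ∈ T <;> by_cases hyT : y ∈ T
    · exact absurd hxy (hT x hxT y hyT)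
    · simpa [hxT, hyT] using (hc y (by simp [hy, hyT])).ne'
    · simpa [hxT, hyT] using (hc x (by simp [hx, hxT])).ne
    · simpa [hxT, hyT] using hc' x (by simp [hx, hxT]) y (by simp [hy, hyT]) hxy

/-- `p 0, …, p m` is an induced path of `G` starting at `v` and continuing in `S`. -/
def IsInducedPathFrom (G : SimpleGraph V) (v : V) (S : Finset V) (m : ℕ) (p : ℕ → V) : Prop :=
  p 0 = v ∧ (∀ i, 1 ≤ i → i ≤ m → p i ∈ S) ∧
    ∀ i j, i < j → j ≤ m → p i ≠ p j ∧ (G.Adj (p i) (p j) ↔ j = i + 1)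

lemma IsInducedPathFrom.cons {u v : V} {m : ℕ} {p : ℕ → V} (hp : G.IsInducedPathFrom u T m p)
    (hTS : T ⊆ S) (hu : u ∈ S) (hv : v ∉ S) (hvu : G.Adj v u) (hvT : ∀ x ∈ T, ¬ G.Adj v x) :
    ∃ q, G.IsInducedPathFrom v S (m + 1) q := by
  obtain ⟨h0, hm, ha⟩ := hp
  have hS : ∀ i ≤ m, p i ∈ S := by
    intro i hi
    rcases Nat.eq_zero_or_pos i with rfl | hpos
    · rwa [h0]
    · exact hTS (hm i hpos hi)
  refine ⟨fun i => Nat.casesOn i v p, rfl, ?_, ?_⟩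
  · rintro (_ | i) h1 h2
    · omega
    · exact hS i (by omega)
  · rintro (_ | i) (_ | j) hij hj
    · omega
    · refine ⟨fun h => hv ?_, ?_⟩
      · change v = p j at h
        rw [h]
        exact hS j (by omega)
      · change G.Adj v (p j) ↔ _
        rcases Nat.eq_zero_or_pos j with rfl | hpos
        · simp [h0, hvu]
        · have := hvT _ (hm j hpos (by omega))
          simp only [this, false_iff]
          omega
    · omega
    · obtain ⟨h1, h2⟩ := ha i j (by omega) (by omega)
      refine ⟨h1, h2.trans ?_⟩
      omega

/-- Gyárfás' path argument for triangle-free graphs. -/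
lemma exists_isInducedPathFrom (hU : ∀ x ∈ U, ∀ y ∈ U, ∀ z ∈ U,
      G.Adj x y → G.Adj x z → ¬ G.Adj y z) {v : V} (hSU : S ⊆ U) (hvU : v ∈ U)
    (hS : G.CutConnected S) (hv : v ∉ S) (hvS : ∃ w ∈ S, G.Adj v w)
    (hcol : ¬ G.ColorableOn S n) : ∃ p, G.IsInducedPathFrom v S (n + 1) p := by
  classical
  induction n generalizing S v with
  | zero =>
    obtain ⟨w, hw, hvw⟩ := hvS
    refine IsInducedPathFrom.cons (u := w) (T := ∅) (p := fun _ => w) (m := 0)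
      ⟨rfl, ?_, ?_⟩ (by simp) hw hv hvw (by simp) <;> intros <;> omega
  | succ n ih =>
    have hN : ¬ G.ColorableOn (S \ S.filter (G.Adj v)) n := by
      refine fun h => hcol (h.succ_of_sdiff fun x hx y hy => ?_)
      rw [Finset.mem_filter] at hx hy
      exact hU v hvU x (hSU hx.1) y (hSU hy.1) hx.2 hy.2
    obtain ⟨C, hCS, hC, hCc, hcl⟩ := exists_cutConnected_not_colorableOn hN
    have hCS' : C ⊆ S := hCS.trans Finset.sdiff_subset
    have hvC : ∀ x ∈ C, ¬ G.Adj v x := by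
      intro x hx hvx
      have := Finset.mem_sdiff.1 (hCS hx)
      exact this.2 (Finset.mem_filter.2 ⟨this.1, hvx⟩)
    have hne : C ≠ S := by
      rintro rfl
      obtain ⟨w, hw, hvw⟩ := hvS
      exact hvC w hw hvw
    obtain ⟨x, hx, u, hu, huC, hxu⟩ := hS C hCS' (nonempty_of_not_colorableOn hC) hne
    have hvu : G.Adj v u := by
      by_contra hvu
      exact huC (hcl x hx u (by simp [hu, hvu]) hxu)
    obtain ⟨p, hp⟩ := ih (hCS'.trans hSU) (hSU hu) hCc huC ⟨x, hx, hxu.symm⟩ hC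
    exact hp.cons hCS' hu hv hvu hvC

lemma colorableOn_four_of_triangleFree (hG : IsIndFree G (pathGraph 6))
    (hU : ∀ x ∈ U, ∀ y ∈ U, ∀ z ∈ U, G.Adj x y → G.Adj x z → ¬ G.Adj y z) :
    G.ColorableOn U 4 := by
  classical
  by_contra hcol
  obtain ⟨S, hSU, hS, hSc, -⟩ := exists_cutConnected_not_colorableOn hcol
  obtain ⟨v, hv⟩ := nonempty_of_not_colorableOn hS
  have hN : ¬ G.ColorableOn (S.erase v \ S.filter (G.Adj v)) 3 := by
    rintro ⟨c, hc, hc'⟩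
    refine hS (ColorableOn.succ_of_sdiff (n := 3) (T := S.filter (G.Adj v)) ?_ ?_)
    · refine ⟨fun x => if x = v then 0 else c x, ?_, ?_⟩
      · intro x hx
        by_cases hxv : x = v
        · simp [hxv]
        · simpa [hxv] using hc x (by simp_all)
      · intro x hx y hy hxy
        simp only [Finset.mem_sdiff, Finset.mem_filter, not_and] at hx hy
        have hxv : x ≠ v := by
          rintro rfl
          exact hy.2 hy.1 hxy
        have hyv : y ≠ v := by
          rintro rfl
          exact hx.2 hx.1 hxy.symm
        simpa [hxv, hyv] using hc' x (by simp_all) y (by simp_all) hxy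
    · intro x hx y hy
      rw [Finset.mem_filter] at hx hy
      exact hU v (hSU hv) x (hSU hx.1) y (hSU hy.1) hx.2 hy.2
  obtain ⟨C, hCS, hC, hCc, hcl⟩ := exists_cutConnected_not_colorableOn hN
  have hCv : C ⊆ S.erase v := hCS.trans Finset.sdiff_subset
  have hCS' : C ⊆ S := hCv.trans (Finset.erase_subset _ _)
  have hvC : ∀ x ∈ C, ¬ G.Adj v x := by
    intro x hx hvx
    exact (Finset.mem_sdiff.1 (hCS hx)).2 (Finset.mem_filter.2 ⟨hCS' hx, hvx⟩)
  have hne : C ≠ S := by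
    rintro rfl
    simpa using hCv hv
  obtain ⟨x, hx, u, hu, huC, hxu⟩ := hSc C hCS' (nonempty_of_not_colorableOn hC) hne
  have huv : u ≠ v := by
    rintro rfl
    exact hvC x hx hxu.symm
  have hvu : G.Adj v u := by
    by_contra hvu
    exact huC (hcl x hx u (by simp [hu, hvu, huv]) hxu)
  obtain ⟨p, hp⟩ := exists_isInducedPathFrom hU (hCS'.trans hSU) (hSU hu) hCc huC
    ⟨x, hx, hxu.symm⟩ hC
  obtain ⟨q, -, -, hq⟩ := hp.cons hCv (Finset.mem_erase.2 ⟨huv, hu⟩) (by simp) hvu hvC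
  refine hG.false_of_map (fun i => q i) fun i j hij => ?_
  obtain ⟨h1, h2⟩ := hq i j hij (by omega)
  refine ⟨h1, ?_⟩
  rw [pathGraph_adj, h2]
  omega

lemma exists_fixedPointFree_injective {α : Type*} (K : Finset α) (hK : 2 ≤ K.card) :
    ∃ σ : α → α, (∀ x ∈ K, σ x ∈ K ∧ σ x ≠ x) ∧ Set.InjOn σ K := by
  classical
  obtain ⟨m, hm⟩ := Nat.exists_eq_add_of_le' hK
  let e : K ≃ Fin (m + 2) := K.equivFinOfCardEq hm
  let τ : Equiv.Perm K := (e.trans (finRotate (m + 2))).trans e.symm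
  have hτ : ∀ x, τ x ≠ x := by
    intro x hx
    simp [τ, Equiv.symm_apply_eq] at hx
  refine ⟨fun x => if h : x ∈ K then τ ⟨x, h⟩ else x, ?_, ?_⟩
  · intro x hx
    simp only [hx, dif_pos]
    exact ⟨(τ ⟨x, hx⟩).2, fun h => hτ ⟨x, hx⟩ (Subtype.ext h)⟩
  · intro x hx y hy hxy
    have hx' : x ∈ K := hx
    have hy' : y ∈ K := hy
    simp only [hx', hy', dif_pos] at hxy
    simpa using τ.injective (Subtype.ext hxy)

/-- A proper colouring extends to a vertex whose neighbours lie in a small clique. -/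
lemma ColorableOn.of_erase [DecidableEq V] {K : Finset V} {a : V}
    (h : G.ColorableOn (S.erase a) n) (haK : a ∈ K) (hKn : K.card ≤ n)
    (hN : ∀ x ∈ S, G.Adj a x → x ∈ K) : G.ColorableOn S n := by
  obtain ⟨c, hc, hc'⟩ := h
  have hlt : ((K.erase a).image c).card < (Finset.range n).card := by
    have := Finset.card_image_le (s := K.erase a) (f := c)
    have := Finset.card_erase_lt_of_mem haK
    simp only [Finset.card_range]
    omega
  obtain ⟨t, ht, htK⟩ := Finset.exists_mem_notMem_of_card_lt_card hlt
  have ht' : ∀ x ∈ S, G.Adj a x → t ≠ c x := by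
    rintro x hx hax rfl
    exact htK (Finset.mem_image_of_mem c (Finset.mem_erase.2 ⟨hax.ne', hN x hx hax⟩))
  refine ⟨fun x => if x = a then t else c x, ?_, ?_⟩
  · intro x hx
    by_cases hxa : x = a
    · simpa [hxa] using ht
    · simpa [hxa] using hc x (by simp [hx, hxa])
  · intro x hx y hy hxy
    by_cases hxa : x = a <;> by_cases hya : y = a
    · exact absurd (hxa.trans hya.symm) hxy.ne
    · subst hxa
      simpa [hya] using ht' y hy hxy
    · subst hya
      simpa [hxa] using (ht' x hx hxy.symm).symm
    · simpa [hxa, hya] using hc' x (by simp [hx, hxa]) y (by simp [hy, hya]) hxy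

/-- A proper colouring extends to a clique each of whose vertices has exactly one neighbour
outside, these neighbours being pairwise adjacent. -/
lemma ColorableOn.of_sdiff_clique [DecidableEq V] {K : Finset V} (h : G.ColorableOn (S \ K) n)
    (hK : 2 ≤ K.card) (g : V → V) (hg : ∀ a ∈ K, g a ∈ S \ K)
    (huniq : ∀ a ∈ K, ∀ x ∈ S \ K, G.Adj a x → x = g a)
    (hadj : ∀ a ∈ K, ∀ b ∈ K, a ≠ b → G.Adj (g a) (g b)) : G.ColorableOn S n := by
  obtain ⟨c, hc, hc'⟩ := h
  obtain ⟨σ, hσ, hinj⟩ := exists_fixedPointFree_injective K hK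
  have hne : ∀ a ∈ K, ∀ b ∈ K, a ≠ b → c (g a) ≠ c (g b) := fun a ha b hb hab =>
    hc' _ (hg a ha) _ (hg b hb) (hadj a ha b hb hab)
  refine ⟨fun x => if x ∈ K then c (g (σ x)) else c x, ?_, ?_⟩
  · intro x hx
    by_cases hxK : x ∈ K
    · simpa [hxK] using hc _ (hg _ (hσ x hxK).1)
    · simpa [hxK] using hc x (by simp [hx, hxK])
  · intro x hx y hy hxy
    by_cases hxK : x ∈ K <;> by_cases hyK : y ∈ K
    · simpa [hxK, hyK] using
        hne _ (hσ x hxK).1 _ (hσ y hyK).1 fun h => hxy.ne (hinj hxK hyK h)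
    · obtain rfl := huniq x hxK y (by simp [hy, hyK]) hxy
      simpa [hxK, hyK] using hne _ (hσ x hxK).1 x hxK (hσ x hxK).2
    · obtain rfl := huniq y hyK x (by simp [hx, hxK]) hxy.symm
      simpa [hxK, hyK] using (hne _ (hσ y hyK).1 y hyK (hσ y hyK).2).symm
    · simpa [hxK, hyK] using hc' x (by simp [hx, hxK]) y (by simp [hy, hyK]) hxy

/-- A set containing a triangle contains a clique of size at least three that no vertex of the
set extends. -/
lemma exists_maximal_clique_of_triangle {x y z : V} (hx : x ∈ S) (hy : y ∈ S) (hz : z ∈ S)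
    (hxy : G.Adj x y) (hxz : G.Adj x z) (hyz : G.Adj y z) :
    ∃ K ⊆ S, G.IsClique (K : Set V) ∧ 3 ≤ K.card ∧
      ∀ w ∈ S, w ∉ K → ∃ d ∈ K, ¬ G.Adj w d := by
  classical
  obtain ⟨K, hK, hmax⟩ := (S.powerset.filter fun K : Finset V => G.IsClique (K : Set V)).exists_max_image
    Finset.card ⟨∅, by simp⟩
  simp only [Finset.mem_filter, Finset.mem_powerset] at hK hmax
  refine ⟨K, hK.1, hK.2, ?_, fun w hw hwK => ?_⟩
  · have h3 := is3Clique_triple_iff.2 ⟨hxy, hxz, hyz⟩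
    rw [← h3.card_eq]
    refine hmax _ ⟨?_, h3.isClique⟩
    intro t ht
    simp only [Finset.mem_insert, Finset.mem_singleton] at ht
    rcases ht with rfl | rfl | rfl <;> assumption
  · by_contra! hcon
    have := hmax (insert w K) ⟨Finset.insert_subset hw hK.1, by
      rw [Finset.coe_insert]
      exact hK.2.insert fun b hb _ => hcon b hb⟩
    rw [Finset.card_insert_of_notMem hwK] at this
    omega

lemma colorableOn_of_card_clique_le {k : ℕ} (hk : 4 ≤ k) (hGp : IsIndFree G (pathGraph 6))
    (hGb : IsIndFree G bull) (hGd : IsIndFree G diamond)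
    (hclique : ∀ K : Finset V, G.IsClique (K : Set V) → K.card ≤ k) (S : Finset V) :
    G.ColorableOn S k := by
  classical
  induction S using Finset.strongInduction with
  | H S ih =>
    by_cases htri : ∀ x ∈ S, ∀ y ∈ S, ∀ z ∈ S, G.Adj x y → G.Adj x z → ¬ G.Adj y z
    · exact (colorableOn_four_of_triangleFree hGp htri).mono hk
    push Not at htri
    obtain ⟨x, hx, y, hy, z, hz, hxy, hxz, hyz⟩ := htri
    obtain ⟨K, hKS, hK, hK3, hmax⟩ := exists_maximal_clique_of_triangle hx hy hz hxy hxz hyz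
    by_cases hA : ∃ a ∈ K, ∀ w ∈ S, G.Adj a w → w ∈ K
    · obtain ⟨a, ha, hN⟩ := hA
      exact (ih _ (Finset.erase_ssubset (hKS ha))).of_erase ha (hclique K hK) hN
    push Not at hA
    choose! g hgS hgadj hgK using hA
    have hone : ∀ a ∈ K, ∀ b ∈ K, a ≠ b → ∀ w ∈ S, w ∉ K → G.Adj a w → ¬ G.Adj b w := by
      intro a ha b hb hab w hw hwK haw hbw
      obtain ⟨d, hd, hwd⟩ := hmax w hw hwK
      have hda : d ≠ a := by
        rintro rfl
        exact hwd haw.symm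
      have hdb : d ≠ b := by
        rintro rfl
        exact hwd hbw.symm
      exact hGd.no_diamond (p := w) (q := d) (fun h : w = d => hwK (h ▸ hd)) hwd haw.symm hbw.symm
        (hK hd ha hda) (hK hd hb hdb) (hK ha hb hab)
    have hthird : ∀ a b, ∃ d ∈ K, d ≠ a ∧ d ≠ b := by
      intro a b
      have : ({a, b} : Finset V).card < K.card := by
        have := Finset.card_le_two (a := a) (b := b)
        omega
      obtain ⟨d, hd, hd'⟩ := Finset.exists_mem_notMem_of_card_lt_card this
      exact ⟨d, hd, by simpa using hd'⟩
    have hcross : ∀ a ∈ K, ∀ b ∈ K, a ≠ b → ∀ w ∈ S, w ∉ K → ∀ w' ∈ S, w' ∉ K →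
        G.Adj a w → G.Adj b w' → G.Adj w w' := by
      intro a ha b hb hab w hw hwK w' hw' hwK' haw hbw
      obtain ⟨d, hd, hda, hdb⟩ := hthird a b
      exact hGb.no_bull (hK ha hb hab) (hK ha hd hda.symm) (hK hb hd hdb.symm) haw hbw
        (hone b hb a ha hab.symm w' hw' hwK' hbw) (hone a ha b hb hab w hw hwK haw)
        (hone a ha d hd hda.symm w hw hwK haw) (hone b hb d hd hdb.symm w' hw' hwK' hbw)
    have hss : S \ K ⊂ S :=
      Finset.sdiff_ssubset hKS (Finset.card_pos.1 (by omega))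
    have hgg : ∀ a ∈ K, ∀ b ∈ K, a ≠ b → G.Adj (g a) (g b) := fun a ha b hb hab =>
      hcross a ha b hb hab _ (hgS a ha) (hgK a ha) _ (hgS b hb) (hgK b hb)
        (hgadj a ha) (hgadj b hb)
    refine (ih _ hss).of_sdiff_clique (by omega) g
      (fun a ha => Finset.mem_sdiff.2 ⟨hgS a ha, hgK a ha⟩) ?_ hgg
    intro a ha w hw haw
    rw [Finset.mem_sdiff] at hw
    by_contra hne
    obtain ⟨b, hb, hba, -⟩ := hthird a a
    obtain ⟨d, hd, hda, hdb⟩ := hthird a b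
    have hto : ∀ e ∈ K, e ≠ a → G.Adj w (g e) := fun e he hea =>
      hcross a ha e he hea.symm w hw.1 hw.2 _ (hgS e he) (hgK e he) haw (hgadj e he)
    by_cases hwg : G.Adj w (g a)
    · refine hGd.no_diamond (p := a) (q := g b) (fun h => hgK b hb (h ▸ ha)) ?_ haw
        (hgadj a ha) (hto b hb hba).symm (hgg b hb a ha hba) hwg
      exact hone b hb a ha hba _ (hgS b hb) (hgK b hb) (hgadj b hb)
    · exact hGd.no_diamond hne hwg (hto b hb hba) (hto d hd hda)
        (hgg a ha b hb hba.symm) (hgg a ha d hd hda.symm) (hgg b hb d hd hdb.symm)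

end SimpleGraph

theorem statement_7 {V : Type*} [Fintype V] (G : SimpleGraph V)
    (hGp : IsIndFree G (pathGraph 6)) (hGb : IsIndFree G bull)
    (hGd : IsIndFree G diamond) (hw : 3 < G.cliqueNum) :
    G.chromaticNumber ≤ (G.cliqueNum : ℕ∞) := by
  apply SimpleGraph.Colorable.chromaticNumber_le
  obtain ⟨c, hc, hc'⟩ := SimpleGraph.colorableOn_of_card_clique_le hw hGp hGb hGd
    (fun K hK => hK.card_le_cliqueNum) Finset.univ
  exact ⟨Coloring.mk (fun x => ⟨c x, hc x (Finset.mem_univ x)⟩) fun {x y} hxy h =>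
    hc' x (Finset.mem_univ x) y (Finset.mem_univ y) hxy (Fin.ext_iff.1 h)⟩
end
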